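/- arXiv:1309.0796 — 3 statements merged into one kernel-verified Lean document; each statement's English description precedes it below -/
import Mathlib

section
/- The positive braid monoid B_n^+ is right-cancellative: for all a, b, c in B_n^+, if b * a = c * a then b = c. -/
/-- The braid relations on the free monoid over `Fin (n - 1)`: the index `i : Fin (n - 1)`
stands for the Artin generator `σ_{i+1}` (indices are 0-based), and the relations are
`σ_i σ_j σ_i = σ_j σ_i σ_j` for `|i - j| = 1` and `σ_i σ_j = σ_j σ_i` for `|i - j| ≥ 2`. -/
def braidRels (n : ℕ) : FreeMonoid (Fin (n - 1)) → FreeMonoid (Fin (n - 1)) → Prop :=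
  fun x y =>
    (∃ i j : Fin (n - 1), (i : ℕ) + 1 = (j : ℕ) ∧
        x = .of i * .of j * .of i ∧ y = .of j * .of i * .of j) ∨
    (∃ i j : Fin (n - 1), (i : ℕ) + 2 ≤ (j : ℕ) ∧
        x = .of i * .of j ∧ y = .of j * .of i)

/-- The positive braid monoid `B_n⁺`, presented by the generators `σ_1, …, σ_{n-1}`
and the braid relations. -/
def BraidMonoid (n : ℕ) := PresentedMonoid (braidRels n)

instance (n : ℕ) : Monoid (BraidMonoid n) :=
  inferInstanceAs (Monoid (PresentedMonoid (braidRels n)))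

/-- The generator `σ_{i+1}` of `B_n⁺` (0-based index `i : Fin (n - 1)`). -/
def σ {n : ℕ} (i : Fin (n - 1)) : BraidMonoid n := PresentedMonoid.of (braidRels n) i

namespace BraidMonoid

variable {n : ℕ}

/-- The projection from words to positive braids. -/
def ofWord (n : ℕ) : FreeMonoid (Fin (n - 1)) →* BraidMonoid n :=
  PresentedMonoid.mk (braidRels n)

theorem ofWord_of (i : Fin (n - 1)) : ofWord n (.of i) = σ i := rfl

theorem ofWord_surjective : Function.Surjective (ofWord n) :=
  PresentedMonoid.surjective_mk

theorem ofWord_eq_iff {u v : FreeMonoid (Fin (n - 1))} :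
    ofWord n u = ofWord n v ↔ conGen (braidRels n) u v :=
  PresentedMonoid.mk_eq_mk_iff

/-- The word length, as a monoid homomorphism. -/
def lengthHom (n : ℕ) : BraidMonoid n →* Multiplicative ℕ :=
  PresentedMonoid.lift (fun _ => Multiplicative.ofAdd 1) (by
    rintro a b (⟨i, j, -, rfl, rfl⟩ | ⟨i, j, -, rfl, rfl⟩) <;> simp)

/-- The length of a positive braid. -/
def length (x : BraidMonoid n) : ℕ := (lengthHom n x).toAdd

@[simp] theorem length_one : length (1 : BraidMonoid n) = 0 := by simp [length]

@[simp] theorem length_mul (x y : BraidMonoid n) : length (x * y) = length x + length y := by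
  simp [length]

@[simp] theorem length_σ (i : Fin (n - 1)) : length (σ i : BraidMonoid n) = 1 := rfl

/-- Two generators whose indices differ by exactly one. -/
def Adjacent (i j : Fin (n - 1)) : Prop := (i : ℕ) + 1 = j ∨ (j : ℕ) + 1 = i

/-- Two generators whose indices differ by at least two. -/
def Distant (i j : Fin (n - 1)) : Prop := (i : ℕ) + 2 ≤ j ∨ (j : ℕ) + 2 ≤ i

theorem Adjacent.symm {i j : Fin (n - 1)} (h : Adjacent i j) : Adjacent j i := Or.symm h

theorem Distant.symm {i j : Fin (n - 1)} (h : Distant i j) : Distant j i := Or.symm h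

theorem Adjacent.ne {i j : Fin (n - 1)} (h : Adjacent i j) : i ≠ j := by
  rintro rfl; unfold Adjacent at h; omega

theorem Distant.ne {i j : Fin (n - 1)} (h : Distant i j) : i ≠ j := by
  rintro rfl; unfold Distant at h; omega

theorem Distant.not_adjacent {i j : Fin (n - 1)} (h : Distant i j) : ¬ Adjacent i j := by
  unfold Distant at h; unfold Adjacent; omega

theorem Adjacent.not_adjacent {i j k : Fin (n - 1)} (h : Adjacent i k) (h' : Adjacent k j) :
    ¬ Adjacent i j := by
  unfold Adjacent at *; omega

theorem Adjacent.mul_braid {i j : Fin (n - 1)} (h : Adjacent i j) (t : BraidMonoid n) :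
    t * σ i * σ j * σ i = t * σ j * σ i * σ j := by
  have key : ∀ i j : Fin (n - 1), (i : ℕ) + 1 = j →
      (σ i * σ j * σ i : BraidMonoid n) = σ j * σ i * σ j := fun i j hij =>
    PresentedMonoid.mk_eq_mk_of_rel (rels := braidRels n) (Or.inl ⟨i, j, hij, rfl, rfl⟩)
  rcases h with h | h
  · simpa only [mul_assoc] using congrArg (t * ·) (key i j h)
  · simpa only [mul_assoc] using congrArg (t * ·) (key j i h).symm

theorem Distant.mul_comm {i j : Fin (n - 1)} (h : Distant i j) (t : BraidMonoid n) :
    t * σ i * σ j = t * σ j * σ i := by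
  have key : ∀ i j : Fin (n - 1), (i : ℕ) + 2 ≤ j →
      (σ i * σ j : BraidMonoid n) = σ j * σ i := fun i j hij =>
    PresentedMonoid.mk_eq_mk_of_rel (rels := braidRels n) (Or.inr ⟨i, j, hij, rfl, rfl⟩)
  rcases h with h | h
  · simpa only [mul_assoc] using congrArg (t * ·) (key i j h)
  · simpa only [mul_assoc] using congrArg (t * ·) (key j i h).symm

/-- The explicit form of the equation `x * σ i = y * σ j`: the common value is a left multiple
of the least common left multiple of `σ i` and `σ j`. -/
inductive LcmFactor : Fin (n - 1) → Fin (n - 1) → BraidMonoid n → BraidMonoid n → Prop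
  | refl (i : Fin (n - 1)) (x : BraidMonoid n) : LcmFactor i i x x
  | distant {i j : Fin (n - 1)} (h : Distant i j) (z : BraidMonoid n) :
      LcmFactor i j (z * σ j) (z * σ i)
  | adjacent {i j : Fin (n - 1)} (h : Adjacent i j) (z : BraidMonoid n) :
      LcmFactor i j (z * σ i * σ j) (z * σ j * σ i)

namespace LcmFactor

variable {i j k : Fin (n - 1)} {x y w : BraidMonoid n}

theorem symm (h : LcmFactor i j x y) : LcmFactor j i y x := by
  cases h with
  | refl => exact .refl _ _
  | distant h z => exact .distant h.symm z
  | adjacent h z => exact .adjacent h.symm z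

theorem mul_left (h : LcmFactor i j x y) (t : BraidMonoid n) :
    LcmFactor i j (t * x) (t * y) := by
  cases h with
  | refl => exact .refl _ _
  | distant h z => simpa only [mul_assoc] using LcmFactor.distant h (t * z)
  | adjacent h z => simpa only [mul_assoc] using LcmFactor.adjacent h (t * z)

theorem eq_of_same (h : LcmFactor i i x y) : x = y := by
  cases h with
  | refl => rfl
  | distant h => exact absurd rfl h.ne
  | adjacent h => exact absurd rfl h.ne

theorem exists_of_distant (h : LcmFactor i j x y) (hij : Distant i j) :
    ∃ z, x = z * σ j ∧ y = z * σ i := by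
  cases h with
  | refl => exact absurd rfl hij.ne
  | distant h z => exact ⟨z, rfl, rfl⟩
  | adjacent h => exact absurd h hij.not_adjacent

theorem exists_of_adjacent (h : LcmFactor i j x y) (hij : Adjacent i j) :
    ∃ z, x = z * σ i * σ j ∧ y = z * σ j * σ i := by
  cases h with
  | refl => exact absurd rfl hij.ne
  | distant h => exact absurd hij h.not_adjacent
  | adjacent h z => exact ⟨z, rfl, rfl⟩

end LcmFactor

/-- Equations `x * σ i = y * σ j` with `x` of length less than `N` have the expected form. -/
def LcmProperty (n N : ℕ) : Prop :=
  ∀ (i j : Fin (n - 1)) (x y : BraidMonoid n), length x < N → x * σ i = y * σ j →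
    LcmFactor i j x y

theorem trans_distant_distant {N : ℕ} (H : LcmProperty n N) {i j k : Fin (n - 1)}
    (hik : Distant i k) (hkj : Distant k j) {z z' : BraidMonoid n}
    (hw : z * σ i = z' * σ j) (hN : length (z * σ i) ≤ N) :
    LcmFactor i j (z * σ k) (z' * σ k) := by
  simp only [length_mul, length_σ] at hN
  cases H i j z z' (by omega) hw with
  | refl => exact .refl _ _
  | distant h t =>
    rw [← hkj.mul_comm, hik.mul_comm]
    exact .distant h _
  | adjacent h t =>
    rw [← hkj.mul_comm, hik.mul_comm, hik.mul_comm, ← hkj.mul_comm]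
    exact .adjacent h _

theorem trans_distant_adjacent {N : ℕ} (H : LcmProperty n N) {i j k : Fin (n - 1)}
    (hik : Distant i k) (hkj : Adjacent k j) {z z' : BraidMonoid n}
    (hw : z * σ i = z' * σ k * σ j) (hN : length (z * σ i) ≤ N) :
    LcmFactor i j (z * σ k) (z' * σ j * σ k) := by
  have hN' := hN
  rw [hw] at hN'
  simp only [length_mul, length_σ] at hN hN'
  generalize hv : z' * σ k = v at hw
  cases H i j z v (by omega) hw with
  | refl => exact absurd hkj.symm hik.not_adjacent
  | distant h t =>
    obtain ⟨s, rfl, rfl⟩ := (H k i z' t (by omega) hv).exists_of_distant hik.symm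
    rw [hkj.mul_braid, h.mul_comm, hik.mul_comm]
    exact .distant h _
  | adjacent h t =>
    obtain ⟨s, rfl, hs⟩ := (H k i z' (t * σ j) (by omega) hv).exists_of_distant hik.symm
    have hlen := congrArg length hs
    simp only [length_mul, length_σ] at hlen hN'
    obtain ⟨r, rfl, rfl⟩ := (H j k t s (by omega) hs).exists_of_adjacent hkj.symm
    have hx : r * σ j * σ k * σ i * σ j * σ k = r * σ i * σ j * σ k * σ i * σ j := by
      rw [← hik.mul_comm, hkj.mul_braid, ← h.mul_braid, hik.mul_comm]
    have hy : r * σ k * σ j * σ i * σ j * σ k = r * σ i * σ j * σ k * σ j * σ i := by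
      rw [← h.mul_braid, ← hik.mul_comm, hik.mul_comm (r * σ i * σ k * σ j), hkj.mul_braid]
    rw [hx, hy]
    exact .adjacent h _

theorem trans_adjacent_adjacent {N : ℕ} (H : LcmProperty n N) {i j k : Fin (n - 1)}
    (hik : Adjacent i k) (hkj : Adjacent k j) {z z' : BraidMonoid n}
    (hw : z * σ k * σ i = z' * σ k * σ j) (hN : length (z * σ k * σ i) ≤ N) :
    LcmFactor i j (z * σ i * σ k) (z' * σ j * σ k) := by
  have hN' := hN
  rw [hw] at hN'
  simp only [length_mul, length_σ] at hN hN'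
  generalize hu : z * σ k = u at hw
  generalize hv : z' * σ k = v at hw
  have hlen := congrArg length hu
  simp only [length_mul, length_σ] at hlen
  cases H i j u v (by omega) hw with
  | refl =>
    rw [(H k k z z' (by omega) (hu.trans hv.symm)).eq_of_same]
    exact .refl _ _
  | adjacent h => exact absurd h (hik.not_adjacent hkj)
  | distant h t =>
    obtain ⟨s, rfl, rfl⟩ := (H k j z t (by omega) hu).exists_of_adjacent hkj
    obtain ⟨r, rfl, hr⟩ := (H k i z' _ (by omega) hv).exists_of_adjacent hik.symm
    simp only [length_mul, length_σ] at hN hN'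
    have hsr := (H k k _ _ (by simp only [length_mul, length_σ]; omega) hr).eq_of_same
    obtain ⟨q, rfl, rfl⟩ := (H j i s r (by omega) hsr).exists_of_distant h.symm
    have hx : q * σ i * σ k * σ j * σ i * σ k = q * σ k * σ i * σ j * σ k * σ j := by
      rw [← h.mul_comm, hik.mul_braid, hkj.mul_braid, ← hkj.mul_braid, hkj.mul_braid]
    have hy : q * σ j * σ k * σ i * σ j * σ k = q * σ k * σ i * σ j * σ k * σ i := by
      rw [h.mul_comm, ← hkj.mul_braid, ← hik.mul_braid, h.mul_comm]
    rw [hx, hy]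
    exact .distant h _

theorem LcmFactor.trans {N : ℕ} (H : LcmProperty n N) {i j k : Fin (n - 1)}
    {x w y : BraidMonoid n} (hw : length w ≤ N) (h₁ : LcmFactor i k x w)
    (h₂ : LcmFactor k j w y) : LcmFactor i j x y := by
  generalize hv : w = v at h₂
  cases h₁ with
  | refl => exact hv ▸ h₂
  | distant hik z =>
    cases h₂ with
    | refl => exact hv ▸ .distant hik z
    | distant hkj z' => exact trans_distant_distant H hik hkj hv hw
    | adjacent hkj z' => exact trans_distant_adjacent H hik hkj hv hw
  | adjacent hik z =>
    cases h₂ with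
    | refl => exact hv ▸ .adjacent hik z
    | distant hkj z' =>
      exact (trans_distant_adjacent H hkj.symm hik.symm hv.symm (hv ▸ hw)).symm
    | adjacent hkj z' => exact trans_adjacent_adjacent H hik hkj hv hw

theorem eq_one_or_eq_mul_of {α : Type*} (u : FreeMonoid α) :
    u = 1 ∨ ∃ v i, u = v * FreeMonoid.of i := by
  rcases List.eq_nil_or_concat' u.toList with h | ⟨v, i, h⟩
  · exact Or.inl h
  · exact Or.inr ⟨FreeMonoid.ofList v, i, h⟩

theorem mul_of_inj {α : Type*} {u v : FreeMonoid α} {i j : α}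
    (h : u * FreeMonoid.of i = v * FreeMonoid.of j) : u = v ∧ i = j := by
  have h' : u.toList ++ [i] = v.toList ++ [j] := h
  simpa using List.append_inj' h' rfl

theorem mul_of_ne_one {α : Type*} {u : FreeMonoid α} {i : α} : u * FreeMonoid.of i ≠ 1 := by
  intro h
  have h' : u.toList ++ [i] = [] := h
  simp at h'

theorem ofWord_eq_one {u : FreeMonoid (Fin (n - 1))} (h : ofWord n u = 1) : u = 1 := by
  rcases eq_one_or_eq_mul_of u with rfl | ⟨v, i, rfl⟩
  · rfl
  · have := congrArg length h
    simp [ofWord_of] at this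

theorem LcmProperty.lcmFactor_of_conGen {N : ℕ} (H : LcmProperty n N)
    {u v : FreeMonoid (Fin (n - 1))} (h : ConGen.Rel (braidRels n) u v) :
    length (ofWord n u) ≤ N + 1 → ∀ u' i v' j, u = u' * .of i → v = v' * .of j →
      LcmFactor i j (ofWord n u') (ofWord n v') := by
  induction h with
  | of u v h =>
    rintro - u' i v' j hu hv
    rcases h with ⟨a, b, hab, rfl, rfl⟩ | ⟨a, b, hab, rfl, rfl⟩
    · obtain ⟨rfl, rfl⟩ := mul_of_inj hu
      obtain ⟨rfl, rfl⟩ := mul_of_inj hv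
      simpa [ofWord_of] using LcmFactor.adjacent (Or.inl hab) 1
    · obtain ⟨rfl, rfl⟩ := mul_of_inj hu
      obtain ⟨rfl, rfl⟩ := mul_of_inj hv
      simpa [ofWord_of] using (LcmFactor.distant (Or.inl hab) 1).symm
  | refl u =>
    rintro - u' i v' j rfl hv
    obtain ⟨rfl, rfl⟩ := mul_of_inj hv
    exact .refl _ _
  | symm h ih =>
    intro hN u' i v' j hu hv
    rw [← ofWord_eq_iff.2 h] at hN
    exact (ih (by assumption) v' j u' i hv hu).symm
  | @trans u w v h₁ h₂ ih₁ ih₂ =>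
    intro hN u' i v' j hu hv
    have huw : ofWord n u = ofWord n w := ofWord_eq_iff.2 h₁
    rcases eq_one_or_eq_mul_of w with rfl | ⟨w', k, rfl⟩
    · rw [map_one] at huw
      exact absurd (hu.symm.trans (ofWord_eq_one huw)) mul_of_ne_one
    · have hw := huw ▸ hN
      refine (ih₁ hN _ _ _ _ hu rfl).trans H ?_ (ih₂ hw _ _ _ _ rfl hv)
      simpa [ofWord_of] using hw
  | @mul w x y z h₁ h₂ ih₁ ih₂ =>
    intro hN u' i v' j hu hv
    rw [map_mul, length_mul] at hN
    have hwx : ofWord n w = ofWord n x := ofWord_eq_iff.2 h₁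
    have hyz : ofWord n y = ofWord n z := ofWord_eq_iff.2 h₂
    rcases eq_one_or_eq_mul_of y with rfl | ⟨y', k, rfl⟩
    · obtain rfl := ofWord_eq_one (hyz.symm.trans (map_one _))
      rw [mul_one] at hu hv
      exact ih₁ (by omega) _ _ _ _ hu hv
    · rcases eq_one_or_eq_mul_of z with rfl | ⟨z', l, rfl⟩
      · exact absurd (ofWord_eq_one (hyz.trans (map_one _))) mul_of_ne_one
      · rw [← mul_assoc] at hu hv
        obtain ⟨rfl, rfl⟩ := mul_of_inj hu
        obtain ⟨rfl, rfl⟩ := mul_of_inj hv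
        rw [map_mul, map_mul, hwx]
        exact (ih₂ (by omega) _ _ _ _ rfl rfl).mul_left _

theorem lcmProperty (n N : ℕ) : LcmProperty n N := by
  induction N with
  | zero => intro i j x y h; omega
  | succ N H =>
    intro i j x y hN h
    obtain ⟨u, rfl⟩ := ofWord_surjective x
    obtain ⟨v, rfl⟩ := ofWord_surjective y
    rw [← ofWord_of, ← ofWord_of, ← map_mul, ← map_mul] at h
    refine H.lcmFactor_of_conGen (ofWord_eq_iff.1 h) ?_ u i v j rfl rfl
    simpa [ofWord_of] using hN

theorem mul_σ_cancel {x y : BraidMonoid n} {i : Fin (n - 1)} (h : x * σ i = y * σ i) : x = y :=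
  (lcmProperty n _ i i x y (Nat.lt_succ_self _) h).eq_of_same

end BraidMonoid

/-- The positive braid monoid `B_n⁺` is right-cancellative. -/
theorem braidMonoid_right_cancellative (n : ℕ) (hn : 1 ≤ n) :
    ∀ a b c : BraidMonoid n, b * a = c * a → b = c := by
  intro a
  obtain ⟨u, rfl⟩ := BraidMonoid.ofWord_surjective a
  induction u using FreeMonoid.inductionOn' with
  | one => simp
  | of_mul i u ih =>
    intro b c h
    rw [map_mul, ← mul_assoc, ← mul_assoc] at h
    exact BraidMonoid.mul_σ_cancel (ih _ _ h)
end

section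
/- In the positive braid monoid B_n^+, conjugation by Garside's fundamental element flips the generators: for every i with 1 ≤ i ≤ n−1, one has σ_i * Δ_n = Δ_n * σ_{n−i}. -/
/-- `desc n k = σ_k σ_{k-1} ⋯ σ_1` (1-based indices; `desc n 0 = 1`). -/
def desc (n : ℕ) : ℕ → BraidMonoid n
  | 0 => 1
  | k + 1 => (if h : k < n - 1 then σ ⟨k, h⟩ else 1) * desc n k

/-- `deltaAux n m` is Garside's fundamental element `Δ_m` computed inside `B_n⁺`:
`Δ_1 = 1` and `Δ_{m+1} = Δ_m ⬝ (σ_m σ_{m-1} ⋯ σ_1)`. -/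
def deltaAux (n : ℕ) : ℕ → BraidMonoid n
  | 0 => 1
  | m + 1 => deltaAux n m * desc n m

/-- Garside's fundamental element `Δ_n` of the positive braid monoid `B_n⁺`. -/
def Δ (n : ℕ) : BraidMonoid n := deltaAux n n

/-- The generator of `B_n⁺` with 0-based index `k : ℕ`, extended by `1` out of range. -/
def natSigma (n k : ℕ) : BraidMonoid n := if h : k < n - 1 then σ ⟨k, h⟩ else 1

theorem natSigma_coe {n : ℕ} (i : Fin (n - 1)) : natSigma n i = σ i := by
  simp [natSigma]

theorem desc_succ (n k : ℕ) : desc n (k + 1) = natSigma n k * desc n k := rfl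

theorem deltaAux_succ (n m : ℕ) : deltaAux n (m + 1) = deltaAux n m * desc n m := rfl

theorem natSigma_commute (n : ℕ) {i j : ℕ} (hij : i + 2 ≤ j) :
    Commute (natSigma n i) (natSigma n j) := by
  unfold natSigma
  split_ifs with hi hj
  · exact Quot.sound (ConGen.Rel.of _ _ (Or.inr ⟨⟨i, hi⟩, ⟨j, hj⟩, hij, rfl, rfl⟩))
  · exact Commute.one_right _
  · exact Commute.one_left _
  · exact Commute.one_left _

theorem natSigma_braid {n i : ℕ} (hi : i + 1 < n - 1) :
    natSigma n i * natSigma n (i + 1) * natSigma n i =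
      natSigma n (i + 1) * natSigma n i * natSigma n (i + 1) := by
  rw [natSigma, natSigma, dif_pos hi, dif_pos (Nat.lt_of_succ_lt hi)]
  exact Quot.sound (ConGen.Rel.of _ _
    (Or.inl ⟨⟨i, Nat.lt_of_succ_lt hi⟩, ⟨i + 1, hi⟩, rfl, rfl, rfl⟩))

theorem natSigma_commute_desc (n : ℕ) {j k : ℕ} (h : k + 1 ≤ j) :
    Commute (natSigma n j) (desc n k) := by
  induction k with
  | zero => exact Commute.one_right _
  | succ k ih => exact (natSigma_commute n h).symm.mul_right (ih (by omega))

theorem natSigma_commute_deltaAux (n : ℕ) {j m : ℕ} (h : m ≤ j) :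
    Commute (natSigma n j) (deltaAux n m) := by
  induction m with
  | zero => exact Commute.one_right _
  | succ m ih => exact (ih (by omega)).mul_right (natSigma_commute_desc n h)

theorem natSigma_mul_desc {n j k : ℕ} (hk : k ≤ n - 1) (hj : j + 1 < k) :
    natSigma n j * desc n k = desc n k * natSigma n (j + 1) := by
  induction k with
  | zero => omega
  | succ k ih =>
    rcases (Nat.lt_succ_iff.mp hj).lt_or_eq with hlt | rfl
    · rw [desc_succ, ← mul_assoc, (natSigma_commute n hlt).eq, mul_assoc,
        ih (by omega) hlt, mul_assoc]
    · rw [desc_succ, desc_succ, ← mul_assoc, ← mul_assoc, natSigma_braid hk, mul_assoc,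
        (natSigma_commute_desc n le_rfl).eq]
      simp only [mul_assoc]

theorem desc_mul_desc_mul_natSigma_zero {n k m : ℕ} (hm : m ≤ n - 1) (hk : k < m) :
    desc n k * desc n m * natSigma n 0 = desc n m * desc n (k + 1) := by
  induction k with
  | zero => rw [desc_succ, desc, mul_one, one_mul]
  | succ k ih =>
    rw [desc_succ n k, mul_assoc, mul_assoc, ← mul_assoc (desc n k), ih (by omega), ← mul_assoc,
      natSigma_mul_desc hm hk, mul_assoc, ← desc_succ]

theorem natSigma_mul_deltaAux {n i j m : ℕ} (hm : m ≤ n) (hij : i + j + 2 = m) :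
    natSigma n i * deltaAux n m = deltaAux n m * natSigma n j := by
  induction m generalizing j with
  | zero => omega
  | succ m ih =>
    cases j with
    | zero =>
      obtain rfl : m = i + 1 := by omega
      rw [deltaAux_succ, deltaAux_succ, ← mul_assoc, ← mul_assoc,
        (natSigma_commute_deltaAux n le_rfl).eq, mul_assoc (deltaAux n i), ← desc_succ,
        mul_assoc, ← desc_mul_desc_mul_natSigma_zero (by omega) i.lt_succ_self]
      simp only [mul_assoc]
    | succ j =>
      rw [deltaAux_succ, ← mul_assoc, ih (j := j) (by omega) (by omega), mul_assoc,
        natSigma_mul_desc (by omega) (by omega), mul_assoc]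

/-- Conjugation by Garside's fundamental element `Δ_n` flips the generators of `B_n⁺`:
`σ_i Δ_n = Δ_n σ_{n-i}` (in 0-based indexing, `σ_{n-i}` is `σ` applied to `i.rev`). -/
theorem sigma_mul_delta (n : ℕ) (hn : 1 ≤ n) (i : Fin (n - 1)) :
    σ i * Δ n = Δ n * σ i.rev := by
  rw [← natSigma_coe, ← natSigma_coe]
  exact natSigma_mul_deltaAux le_rfl (by rw [Fin.val_rev]; omega)
end

section
/- The square of Garside's fundamental element, Δ_n², is central in the braid group B_n: it commutes with every element of B_n. -/
/-- The braid relators in the free group over `Fin (n - 1)`: the index `i` stands for the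
Artin generator `σ_{i+1}` (indices are 0-based), and the relators express
`σ_i σ_j σ_i = σ_j σ_i σ_j` for `|i - j| = 1` and `σ_i σ_j = σ_j σ_i` for `|i - j| ≥ 2`. -/
def braidRelsGroup (n : ℕ) : Set (FreeGroup (Fin (n - 1))) :=
  { r | (∃ i j : Fin (n - 1), (i : ℕ) + 1 = (j : ℕ) ∧
          r = .of i * .of j * .of i * (.of j * .of i * .of j)⁻¹) ∨
        (∃ i j : Fin (n - 1), (i : ℕ) + 2 ≤ (j : ℕ) ∧
          r = .of i * .of j * (.of j * .of i)⁻¹) }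

/-- The braid group `B_n`, presented by the generators `σ_1, …, σ_{n-1}` and the
braid relations. -/
def BraidGroup (n : ℕ) := PresentedGroup (braidRelsGroup n)

instance (n : ℕ) : Group (BraidGroup n) :=
  inferInstanceAs (Group (PresentedGroup (braidRelsGroup n)))

/-- The generator `σ_{i+1}` of the braid group `B_n` (0-based index `i : Fin (n - 1)`). -/
def σG {n : ℕ} (i : Fin (n - 1)) : BraidGroup n := PresentedGroup.of i

/-- `descG n k = σ_k σ_{k-1} ⋯ σ_1` in the braid group `B_n` (1-based indices). -/
def descG (n : ℕ) : ℕ → BraidGroup n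
  | 0 => 1
  | k + 1 => (if h : k < n - 1 then σG ⟨k, h⟩ else 1) * descG n k

/-- `deltaAuxG n m` is Garside's fundamental element `Δ_m` computed inside `B_n`:
`Δ_1 = 1` and `Δ_{m+1} = Δ_m ⬝ (σ_m σ_{m-1} ⋯ σ_1)`. -/
def deltaAuxG (n : ℕ) : ℕ → BraidGroup n
  | 0 => 1
  | m + 1 => deltaAuxG n m * descG n m

/-- Garside's fundamental element `Δ_n`, as an element of the braid group `B_n`. -/
def ΔG (n : ℕ) : BraidGroup n := deltaAuxG n n

/-- The generator `σ_{k+1}` of `B_n`, extended by `1` to all natural numbers `k`. -/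
def natGen (n k : ℕ) : BraidGroup n := if h : k < n - 1 then σG ⟨k, h⟩ else 1

lemma descG_succ (n k : ℕ) : descG n (k + 1) = natGen n k * descG n k := rfl

lemma deltaAuxG_succ (n m : ℕ) : deltaAuxG n (m + 1) = deltaAuxG n m * descG n m := rfl

lemma natGen_braid (n k : ℕ) (h : k + 1 < n - 1) :
    natGen n k * natGen n (k + 1) * natGen n k =
      natGen n (k + 1) * natGen n k * natGen n (k + 1) := by
  rw [natGen, natGen, dif_pos h, dif_pos (Nat.lt_of_succ_lt h)]
  exact PresentedGroup.mk_eq_mk_of_mul_inv_mem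
    (Or.inl ⟨⟨k, Nat.lt_of_succ_lt h⟩, ⟨k + 1, h⟩, rfl, rfl⟩)

lemma natGen_commute (n i j : ℕ) (h : i + 2 ≤ j) : Commute (natGen n i) (natGen n j) := by
  rw [natGen, natGen]
  split_ifs with hi hj
  · exact PresentedGroup.mk_eq_mk_of_mul_inv_mem (Or.inr ⟨⟨i, hi⟩, ⟨j, hj⟩, h, rfl⟩)
  all_goals simp

lemma natGen_commute_descG (n k j : ℕ) (h : k < j) : Commute (natGen n j) (descG n k) := by
  induction k with
  | zero => exact Commute.one_right _
  | succ k ih =>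
    exact (natGen_commute n k j h).symm.mul_right (ih (by omega))

lemma natGen_commute_deltaAuxG (n m j : ℕ) (h : m ≤ j) :
    Commute (natGen n j) (deltaAuxG n m) := by
  induction m with
  | zero => exact Commute.one_right _
  | succ m ih =>
    exact (ih (by omega)).mul_right (natGen_commute_descG n m j h)

lemma descG_semiconjBy (n m i : ℕ) (hi : i + 1 < m) (hm : m ≤ n - 1) :
    SemiconjBy (descG n m) (natGen n (i + 1)) (natGen n i) := by
  induction m, hi using Nat.le_induction with
  | base =>
    rw [SemiconjBy, descG_succ, descG_succ, mul_assoc, mul_assoc,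
      ← (natGen_commute_descG n i (i + 1) (by omega)).eq]
    simp only [← mul_assoc]
    rw [natGen_braid n i (by omega)]
  | succ m hi ih =>
    exact SemiconjBy.mul_left (natGen_commute n i m (by omega)).symm (ih (by omega))

lemma descG_mul_descG_succ_semiconjBy (n k : ℕ) (hk : k < n - 1) :
    SemiconjBy (descG n k * descG n (k + 1)) (natGen n 0) (natGen n k) := by
  induction k with
  | zero => simp [SemiconjBy, descG_succ, show descG n 0 = 1 from rfl]
  | succ k ih =>
    have key : descG n (k + 1) * descG n (k + 2) =
        natGen n k * natGen n (k + 1) * (descG n k * descG n (k + 1)) := by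
      rw [descG_succ n (k + 1)]
      nth_rw 1 [descG_succ n k]
      simp only [mul_assoc]
      rw [(natGen_commute_descG n k (k + 1) (by omega)).left_comm]
    rw [key]
    exact SemiconjBy.mul_left
      (by rw [SemiconjBy, natGen_braid n k hk, mul_assoc]) (ih (by omega))

/-- `Δ_m σ_j = σ_{m-j} Δ_m` for `1 ≤ j < m ≤ n`, with `j = i + 1`. -/
lemma deltaAuxG_semiconjBy (n m i : ℕ) (hi : i + 2 ≤ m) (hm : m ≤ n) :
    SemiconjBy (deltaAuxG n m) (natGen n i) (natGen n (m - 2 - i)) := by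
  induction m generalizing i with
  | zero => omega
  | succ m ih =>
    cases i with
    | zero =>
      obtain ⟨k, rfl⟩ : ∃ k, m = k + 1 := ⟨m - 1, by omega⟩
      rw [deltaAuxG_succ, deltaAuxG_succ, mul_assoc]
      exact SemiconjBy.mul_left (natGen_commute_deltaAuxG n k k le_rfl).symm
        (descG_mul_descG_succ_semiconjBy n k (by omega))
    | succ i =>
      rw [show m + 1 - 2 - (i + 1) = m - 2 - i by omega]
      exact SemiconjBy.mul_left (ih i (by omega) (by omega))
        (descG_semiconjBy n m i (by omega) (by omega))

lemma commute_ΔG_sq_σG {n : ℕ} (i : Fin (n - 1)) : Commute (ΔG n ^ 2) (σG i) := by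
  have hi := i.isLt
  have h₁ := deltaAuxG_semiconjBy n n i (by omega) le_rfl
  have h₂ := deltaAuxG_semiconjBy n n (n - 2 - i) (by omega) le_rfl
  rw [show n - 2 - (n - 2 - i) = i by omega] at h₂
  have h := h₂.mul_left h₁
  rwa [natGen, dif_pos hi, ← pow_two] at h

/-- The square `Δ_n²` of Garside's fundamental element is central in the braid group
`B_n`. -/
theorem delta_sq_central (n : ℕ) (hn : 1 ≤ n) (x : BraidGroup n) :
    ΔG n ^ 2 * x = x * ΔG n ^ 2 := by
  have hx : x ∈ Subgroup.closure (Set.range (σG (n := n))) := by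
    have h := PresentedGroup.closure_range_of (braidRelsGroup n)
    exact h.ge (Subgroup.mem_top x)
  have hle : Subgroup.closure (Set.range (σG (n := n))) ≤ Subgroup.centralizer {ΔG n ^ 2} := by
    rw [Subgroup.closure_le]
    rintro _ ⟨i, rfl⟩
    exact Subgroup.mem_centralizer_singleton_iff.mpr (commute_ΔG_sq_σG i).eq.symm
  exact (Subgroup.mem_centralizer_singleton_iff.mp (hle hx)).symm
end
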